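/- Let z and w be hyperbolic numbers with z∧w and z∨w defined as the componentwise (in the idempotent representation) minimum and maximum, and let v be a 2×2 real matrix. Then the following are equivalent: (1) there exists a hyperbolic number τ with 0 ≤ τ ≤ I₂ in the Loewner order such that v = z∧w + τ·(z∨w − z∧w) (matrix product); (2) v is a hyperbolic number and z∧w ≤ v ≤ z∨w in the Loewner order. -/

import Mathlib

/-- The hyperbolic number `[[a, b], [b, a]]`. -/
def hyp (a b : ℝ) : Matrix (Fin 2) (Fin 2) ℝ := !![a, b; b, a]

/-- The meet `z ∧ w` of the hyperbolic numbers `z = [[a,b],[b,a]]` and `w = [[c,d],[d,c]]`: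
`½ [[m₊ + m₋, m₊ − m₋], [m₊ − m₋, m₊ + m₋]]` with `m₊ = min (a+b) (c+d)`, `m₋ = min (a−b) (c−d)`. -/
noncomputable def hypMeet (a b c d : ℝ) : Matrix (Fin 2) (Fin 2) ℝ :=
  (1/2 : ℝ) • !![min (a+b) (c+d) + min (a-b) (c-d), min (a+b) (c+d) - min (a-b) (c-d);
                 min (a+b) (c+d) - min (a-b) (c-d), min (a+b) (c+d) + min (a-b) (c-d)]

/-- The join `z ∨ w` of the hyperbolic numbers `z = [[a,b],[b,a]]` and `w = [[c,d],[d,c]]`. -/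
noncomputable def hypJoin (a b c d : ℝ) : Matrix (Fin 2) (Fin 2) ℝ :=
  (1/2 : ℝ) • !![max (a+b) (c+d) + max (a-b) (c-d), max (a+b) (c+d) - max (a-b) (c-d);
                 max (a+b) (c+d) - max (a-b) (c-d), max (a+b) (c+d) + max (a-b) (c-d)]

theorem hyp_add (a b c d : ℝ) : hyp a b + hyp c d = hyp (a + c) (b + d) := by
  ext i j; fin_cases i <;> fin_cases j <;> simp [hyp]

theorem hyp_sub (a b c d : ℝ) : hyp a b - hyp c d = hyp (a - c) (b - d) := by
  ext i j; fin_cases i <;> fin_cases j <;> simp [hyp]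

theorem hyp_mul (a b c d : ℝ) :
    hyp a b * hyp c d = hyp (a * c + b * d) (a * d + b * c) := by
  ext i j; fin_cases i <;> fin_cases j <;> simp [hyp] <;> ring

theorem hyp_one_zero : (1 : Matrix (Fin 2) (Fin 2) ℝ) = hyp 1 0 := by
  ext i j; fin_cases i <;> fin_cases j <;> simp [hyp]

theorem hyp_posSemidef_iff (p q : ℝ) :
    (hyp p q).PosSemidef ↔ 0 ≤ p + q ∧ 0 ≤ p - q := by
  constructor
  · intro h
    have h₁ := h.dotProduct_mulVec_nonneg ![1, 1]
    have h₂ := h.dotProduct_mulVec_nonneg ![1, -1]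
    simp [hyp, Matrix.mulVec, dotProduct, Fin.sum_univ_two] at h₁ h₂
    constructor <;> linarith
  · rintro ⟨h₁, h₂⟩
    refine Matrix.PosSemidef.of_dotProduct_mulVec_nonneg ?_ fun x => ?_
    · ext i j; fin_cases i <;> fin_cases j <;> simp [hyp]
    · simp only [hyp, Matrix.mulVec, dotProduct, Fin.sum_univ_two, Matrix.of_apply,
        Matrix.cons_val_zero, Matrix.cons_val_one, Pi.star_apply, star_trivial]
      nlinarith [mul_nonneg h₁ (sq_nonneg (x 0 + x 1)), mul_nonneg h₂ (sq_nonneg (x 0 - x 1))]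

/-- The hyperbolic number with idempotent components `s` and `t`. -/
noncomputable def hypIdem (s t : ℝ) : Matrix (Fin 2) (Fin 2) ℝ :=
  hyp ((s + t) / 2) ((s - t) / 2)

theorem hyp_eq_hypIdem (p q : ℝ) : hyp p q = hypIdem (p + q) (p - q) := by
  unfold hypIdem; congr 1 <;> ring

theorem exists_eq_hyp_iff (v : Matrix (Fin 2) (Fin 2) ℝ) :
    (∃ p q : ℝ, v = hyp p q) ↔ ∃ s t : ℝ, v = hypIdem s t :=
  ⟨fun ⟨p, q, h⟩ => ⟨_, _, h.trans (hyp_eq_hypIdem p q)⟩, fun ⟨_, _, h⟩ => ⟨_, _, h⟩⟩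

theorem hypIdem_add (s t s' t' : ℝ) :
    hypIdem s t + hypIdem s' t' = hypIdem (s + s') (t + t') := by
  unfold hypIdem; rw [hyp_add]; congr 1 <;> ring

theorem hypIdem_sub (s t s' t' : ℝ) :
    hypIdem s t - hypIdem s' t' = hypIdem (s - s') (t - t') := by
  unfold hypIdem; rw [hyp_sub]; congr 1 <;> ring

theorem hypIdem_mul (s t s' t' : ℝ) :
    hypIdem s t * hypIdem s' t' = hypIdem (s * s') (t * t') := by
  unfold hypIdem; rw [hyp_mul]; congr 1 <;> ring

theorem hypIdem_one : (1 : Matrix (Fin 2) (Fin 2) ℝ) = hypIdem 1 1 := by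
  rw [hyp_one_zero, hyp_eq_hypIdem]; norm_num

theorem hypIdem_posSemidef_iff (s t : ℝ) : (hypIdem s t).PosSemidef ↔ 0 ≤ s ∧ 0 ≤ t := by
  rw [hypIdem, hyp_posSemidef_iff]; ring_nf

theorem hypMeet_eq_hypIdem (a b c d : ℝ) :
    hypMeet a b c d = hypIdem (min (a + b) (c + d)) (min (a - b) (c - d)) := by
  ext i j; fin_cases i <;> fin_cases j <;> simp [hypMeet, hypIdem, hyp] <;> ring

theorem hypJoin_eq_hypIdem (a b c d : ℝ) :
    hypJoin a b c d = hypIdem (max (a + b) (c + d)) (max (a - b) (c - d)) := by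
  ext i j; fin_cases i <;> fin_cases j <;> simp [hypJoin, hypIdem, hyp] <;> ring

theorem add_mul_sub_mem_Icc {m M r : ℝ} (hm : m ≤ M) (h₀ : 0 ≤ r) (h₁ : r ≤ 1) :
    m ≤ m + r * (M - m) ∧ m + r * (M - m) ≤ M := by
  constructor <;> nlinarith

theorem exists_eq_add_mul_sub {m M x : ℝ} (h₀ : m ≤ x) (h₁ : x ≤ M) :
    ∃ r : ℝ, 0 ≤ r ∧ r ≤ 1 ∧ x = m + r * (M - m) := by
  rcases (h₀.trans h₁).eq_or_lt with h | h
  · exact ⟨0, le_rfl, zero_le_one, by linarith⟩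
  · have hpos : 0 < M - m := sub_pos.2 h
    refine ⟨(x - m) / (M - m), div_nonneg (by linarith) hpos.le,
      (div_le_one hpos).2 (by linarith), ?_⟩
    field_simp
    ring

theorem stmt_13 (a b c d : ℝ) (v : Matrix (Fin 2) (Fin 2) ℝ) :
    (∃ τ : Matrix (Fin 2) (Fin 2) ℝ, (∃ p q : ℝ, τ = hyp p q) ∧
        τ.PosSemidef ∧ ((1 : Matrix (Fin 2) (Fin 2) ℝ) - τ).PosSemidef ∧
        v = hypMeet a b c d + τ * (hypJoin a b c d - hypMeet a b c d)) ↔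
      ((∃ p q : ℝ, v = hyp p q) ∧
        (v - hypMeet a b c d).PosSemidef ∧ (hypJoin a b c d - v).PosSemidef) := by
  rw [hypMeet_eq_hypIdem, hypJoin_eq_hypIdem, exists_eq_hyp_iff]
  constructor
  · rintro ⟨τ, hτ, hτ₀, hτ₁, rfl⟩
    obtain ⟨s, t, rfl⟩ := (exists_eq_hyp_iff τ).1 hτ
    rw [hypIdem_one, hypIdem_sub, hypIdem_posSemidef_iff] at hτ₁
    rw [hypIdem_posSemidef_iff] at hτ₀
    obtain ⟨hs, hs'⟩ := add_mul_sub_mem_Icc (min_le_max (a := a + b) (b := c + d)) hτ₀.1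
      (sub_nonneg.1 hτ₁.1)
    obtain ⟨ht, ht'⟩ := add_mul_sub_mem_Icc (min_le_max (a := a - b) (b := c - d)) hτ₀.2
      (sub_nonneg.1 hτ₁.2)
    rw [hypIdem_sub, hypIdem_mul, hypIdem_add, hypIdem_sub, hypIdem_sub,
      hypIdem_posSemidef_iff, hypIdem_posSemidef_iff]
    exact ⟨⟨_, _, rfl⟩, ⟨sub_nonneg.2 hs, sub_nonneg.2 ht⟩, sub_nonneg.2 hs', sub_nonneg.2 ht'⟩
  · rintro ⟨⟨x, y, rfl⟩, h₀, h₁⟩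
    rw [hypIdem_sub, hypIdem_posSemidef_iff] at h₀ h₁
    obtain ⟨s, hs₀, hs₁, hs⟩ := exists_eq_add_mul_sub (sub_nonneg.1 h₀.1) (sub_nonneg.1 h₁.1)
    obtain ⟨t, ht₀, ht₁, ht⟩ := exists_eq_add_mul_sub (sub_nonneg.1 h₀.2) (sub_nonneg.1 h₁.2)
    refine ⟨hypIdem s t, ⟨_, _, rfl⟩, (hypIdem_posSemidef_iff s t).2 ⟨hs₀, ht₀⟩, ?_, ?_⟩
    · rw [hypIdem_one, hypIdem_sub, hypIdem_posSemidef_iff]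
      exact ⟨sub_nonneg.2 hs₁, sub_nonneg.2 ht₁⟩
    · rw [hypIdem_sub, hypIdem_mul, hypIdem_add, ← hs, ← ht]
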